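/- Since every degree-t irreducible polynomial arises from exactly t period-t vectors (its t cyclic shifts), and at least one of every two consecutive vectors in the lexicographic order on F_q^t has period t, the first 2tm vectors of F_q^t in lexicographic order contain period-t vectors generating at least m distinct irreducible polynomials of degree t over F_q. -/

import Mathlib

open Classical in
/-- A vector `x ∈ F^t` has (full) period `t` if its `t` cyclic shifts are pairwise
distinct. -/
def HasFullPeriod {F : Type*} {t : ℕ} (x : Fin t → F) : Prop :=
  Function.Injective fun k : Fin t => fun i : Fin t => x (i - k)

instance {F : Type*} [Fintype F] {t : ℕ} : Fintype (Lex (Fin t → F)) :=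
  inferInstanceAs (Fintype (Fin t → F))

open Finset

/-- Elements of a covering pair of vectors agree up to some index, where the first is smaller;
beyond it the first vector is maximal and the second is minimal. -/
lemma Pi.exists_carry_of_covBy_lex {F : Type*} [LinearOrder F] {t : ℕ}
    {v w : Lex (Fin t → F)} (h : v ⋖ w) :
    ∃ j : Fin t, (∀ i < j, ofLex v i = ofLex w i) ∧ ofLex v j < ofLex w j ∧
      ∀ i > j, ∀ a : F, a ≤ ofLex v i ∧ ofLex w i ≤ a := by
  obtain ⟨j, hj, hlt⟩ := h.lt
  refine ⟨j, hj, hlt, fun i hi a => ⟨?_, ?_⟩⟩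
  · by_contra! ha
    refine h.2 (c := toLex (Function.update (ofLex v) i a)) ⟨i, fun k hk => ?_, ?_⟩
      ⟨j, fun k hk => ?_, ?_⟩
    · change ofLex v k = Function.update (ofLex v) i a k
      rw [Function.update_of_ne hk.ne]
    · change ofLex v i < Function.update (ofLex v) i a i
      rwa [Function.update_self]
    · change Function.update (ofLex v) i a k = ofLex w k
      rw [Function.update_of_ne (hk.trans hi).ne]
      exact hj k hk
    · change Function.update (ofLex v) i a j < ofLex w j
      rwa [Function.update_of_ne hi.ne]
  · by_contra! ha
    refine h.2 (c := toLex (Function.update (ofLex w) i a)) ⟨j, fun k hk => ?_, ?_⟩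
      ⟨i, fun k hk => ?_, ?_⟩
    · change ofLex v k = Function.update (ofLex w) i a k
      rw [Function.update_of_ne (hk.trans hi).ne]
      exact hj k hk
    · change ofLex v j < Function.update (ofLex w) i a j
      rwa [Function.update_of_ne hi.ne]
    · change Function.update (ofLex w) i a k = ofLex w k
      rw [Function.update_of_ne hk.ne]
    · change Function.update (ofLex w) i a i < ofLex w i
      rwa [Function.update_self]

/-- A function on `ℤ` with periods `a` and `b` has period `gcd a b`. -/
lemma Function.Periodic.int_gcd {F : Type*} {f : ℤ → F} {a b : ℤ}
    (ha : Function.Periodic f a) (hb : Function.Periodic f b) :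
    Function.Periodic f (Int.gcd a b) := by
  rw [Int.gcd_eq_gcd_ab, mul_comm a, mul_comm b]
  exact (ha.int_mul _).add_period (hb.int_mul _)

/-- A vector without full period is periodic with a period properly dividing its length. -/
lemma exists_period_of_not_hasFullPeriod {F : Type*} {t : ℕ} {x : Fin t → F}
    (hx : ¬ HasFullPeriod x) :
    ∃ d, d ∣ t ∧ 0 < d ∧ d < t ∧
      ∀ i k : Fin t, (i : ℕ) ≡ k [MOD d] → x i = x k := by
  obtain ⟨k, l, hkl, hne⟩ := Function.not_injective_iff.mp hx
  have ht : 0 < t := k.pos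
  have : NeZero t := ⟨ht.ne'⟩
  let f : ℤ → F := fun n => x (Fin.ofNat t (n % t).toNat)
  have hfx : ∀ i : Fin t, f (i : ℕ) = x i := fun i => by
    simp only [f]
    congr 1
    ext
    norm_cast
    simp [Nat.mod_eq_of_lt i.2]
  have hft : Function.Periodic f t := fun n => by simp [f]
  have hfk : Function.Periodic f ((k : ℕ) - (l : ℕ) : ℤ) := fun n => by
    have key := congrFun hkl (Fin.ofNat t ((n + k) % t).toNat)
    have hsub : ∀ (a : ℤ) (s : Fin t),
        f (a - (s : ℕ)) = x (Fin.ofNat t (a % t).toNat - s) := fun a s => by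
      simp only [f]
      congr 1
      ext
      have h0 : 0 ≤ a % t := Int.emod_nonneg _ (by omega)
      have h1 : 0 ≤ (a - (s : ℕ)) % t := Int.emod_nonneg _ (by omega)
      zify
      rw [Fin.sub_def]
      simp only [Fin.val_ofNat, Int.natCast_mod, Int.natCast_add, Int.toNat_of_nonneg h0,
        Int.toNat_of_nonneg h1, Nat.cast_sub s.2.le]
      rw [Int.emod_emod_of_dvd _ dvd_rfl, Int.emod_emod_of_dvd _ dvd_rfl,
        show ((t : ℤ) - (s : ℕ) + a % t) = (a % t - (s : ℕ)) + t by ring, Int.add_emod_right,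
        Int.emod_sub_emod]
    simp only [← hsub] at key
    rw [show n + ((k : ℕ) - (l : ℕ) : ℤ) = n + (k : ℕ) - (l : ℕ) by ring, ← key]
    congr 1
    ring
  have hne' : (k : ℕ) ≠ l := fun h => hne (Fin.ext h)
  have hd0 : 0 < Int.gcd t ((k : ℕ) - (l : ℕ) : ℤ) := Int.gcd_pos_of_ne_zero_left _ (by omega)
  refine ⟨Int.gcd t ((k : ℕ) - (l : ℕ) : ℤ), ?_, hd0, ?_, fun i s his => ?_⟩
  · exact_mod_cast Int.gcd_dvd_left (t : ℤ) ((k : ℕ) - (l : ℕ) : ℤ)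
  · have h := Int.le_of_dvd (abs_pos.mpr (by omega))
      ((dvd_abs _ _).mpr (Int.gcd_dvd_right (t : ℤ) ((k : ℕ) - (l : ℕ) : ℤ)))
    have : |((k : ℕ) - (l : ℕ) : ℤ)| < t := by
      rw [abs_lt]
      constructor <;> omega
    omega
  · obtain ⟨c, hc⟩ := (Nat.modEq_iff_dvd.mp his)
    rw [← hfx, ← hfx, show ((s : ℕ) : ℤ) = (i : ℕ) +
      c * (Int.gcd t ((k : ℕ) - (l : ℕ) : ℤ) : ℤ) by rw [mul_comm, ← hc]; ring]
    exact ((hft.int_gcd hfk).int_mul c _).symm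

/-- Two distinct proper divisors of `t` sum to less than `t`. -/
lemma Nat.add_lt_of_dvd_of_ne {t d e : ℕ} (hd : d ∣ t) (he : e ∣ t) (hdt : d < t) (het : e < t)
    (hne : d ≠ e) : d + e < t := by
  obtain ⟨a, ha⟩ := hd
  obtain ⟨b, hb⟩ := he
  have ha2 : 2 ≤ a := by
    by_contra! h
    interval_cases a <;> omega
  have hb2 : 2 ≤ b := by
    by_contra! h
    interval_cases b <;> omega
  have h1 : d * 2 ≤ t := ha ▸ Nat.mul_le_mul_left d ha2
  have h2 : e * 2 ≤ t := hb ▸ Nat.mul_le_mul_left e hb2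
  omega

/-- At least one of two consecutive vectors in the lexicographic order has full period. -/
lemma hasFullPeriod_or_of_covBy_lex {F : Type*} [LinearOrder F] {t : ℕ}
    {v w : Lex (Fin t → F)} (h : v ⋖ w) :
    HasFullPeriod (ofLex v) ∨ HasFullPeriod (ofLex w) := by
  by_contra! hvw
  obtain ⟨j, hpre, hj, hsuf⟩ := Pi.exists_carry_of_covBy_lex h
  obtain ⟨d, hdt, hd0, hdlt, hd⟩ := exists_period_of_not_hasFullPeriod hvw.1
  obtain ⟨e, het, he0, helt, he⟩ := exists_period_of_not_hasFullPeriod hvw.2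
  have tail : ∀ c, 0 < c → (j : ℕ) + c < t →
      ∃ i > j, (i : ℕ) ≡ j [MOD c] := fun c hc0 hjc =>
    ⟨⟨j + c, hjc⟩, by simp [Fin.lt_def, hc0], by simp [Nat.ModEq]⟩
  have hjd : t ≤ j + d := by
    by_contra! hlt
    obtain ⟨i, hij, hi⟩ := tail d hd0 hlt
    exact (hj.trans_le ((hsuf i hij _).1.trans_eq (hd i j hi))).false
  have hje : t ≤ j + e := by
    by_contra! hlt
    obtain ⟨i, hij, hi⟩ := tail e he0 hlt
    exact (hj.trans_le' ((he i j hi).symm.trans_le (hsuf i hij _).2)).false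
  have hlast : ofLex v ⟨t - 1, by omega⟩ ≠ ofLex w ⟨t - 1, by omega⟩ := fun heq => by
    rcases eq_or_lt_of_le (show (j : ℕ) ≤ t - 1 by omega) with hjt | hjt
    · have : j = ⟨t - 1, by omega⟩ := Fin.ext hjt
      rw [← this] at heq
      exact hj.ne heq
    · have h1 := (hsuf ⟨t - 1, by omega⟩ hjt (ofLex w j)).1
      have h2 := (hsuf ⟨t - 1, by omega⟩ hjt (ofLex v j)).2
      exact (hj.trans_le (h1.trans (heq.trans_le h2))).false
  have step : ∀ c n : ℕ, c ≤ n → n ≡ n - c [MOD c] := fun c n hcn =>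
    ((Nat.modEq_iff_dvd' (by omega)).mpr (by rw [Nat.sub_sub_self hcn])).symm
  have hpre' : ∀ n (hn : n < t), n < j → ofLex v ⟨n, hn⟩ = ofLex w ⟨n, hn⟩ :=
    fun n hn hnj => hpre ⟨n, hn⟩ hnj
  apply hlast
  rw [hd ⟨t - 1, by omega⟩ ⟨t - 1 - d, by omega⟩ (step d (t - 1) (by omega)),
    hpre' _ _ (by omega)]
  rcases eq_or_ne d e with rfl | hne
  · exact (he _ _ (step d (t - 1) (by omega))).symm
  have hde := Nat.add_lt_of_dvd_of_ne hdt het hdlt helt hne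
  rw [he ⟨t - 1, by omega⟩ ⟨t - 1 - e, by omega⟩ (step e (t - 1) (by omega)),
    ← hpre' (t - 1 - e) _ (by omega),
    he ⟨t - 1 - d, by omega⟩ ⟨t - 1 - d - e, by omega⟩ (step e (t - 1 - d) (by omega)),
    hd ⟨t - 1 - e, by omega⟩ ⟨t - 1 - e - d, by omega⟩ (step d (t - 1 - e) (by omega)),
    hpre' _ _ (by omega)]
  simp only [Nat.sub_right_comm]

/-- In a finite linear order where one of any two consecutive elements satisfies `P`, at least
`n` of the first `2 * n` elements satisfy `P`. -/
lemma le_card_filter_of_covBy {β : Type*} [LinearOrder β] [Fintype β] (P : β → Prop)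
    [DecidablePred P] (hP : ∀ v w : β, v ⋖ w → P v ∨ P w) {n : ℕ}
    (hn : 2 * n ≤ Fintype.card β) :
    n ≤ #{v : β | #{w : β | w < v} < 2 * n ∧ P v} := by
  let e : Fin (Fintype.card β) ≃o β := monoEquivOfFin β rfl
  have hrank : ∀ i, #{w : β | w < e i} = (i : ℕ) := fun i => by
    rw [← Fin.card_Iio i, ← card_map e.toEquiv.toEmbedding]
    congr 1
    ext w
    simp [e.symm_apply_lt]
  have hpair : ∀ k : Fin n, ∃ i : Fin (Fintype.card β), (i : ℕ) / 2 = k ∧ P (e i) := fun k => by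
    have hk := k.2
    have hcov : (⟨2 * k, by omega⟩ : Fin (Fintype.card β)) ⋖ ⟨2 * k + 1, by omega⟩ :=
      ⟨by simp [Fin.lt_def], fun c h1 h2 => by simp only [Fin.lt_def] at h1 h2; omega⟩
    rcases hP _ _ ((apply_covBy_apply_iff e).mpr hcov) with h | h
    · exact ⟨_, by simp, h⟩
    · exact ⟨_, by simp only; omega, h⟩
  choose g hg hPg using hpair
  calc n = #(univ : Finset (Fin n)) := by simp
    _ ≤ _ := card_le_card_of_injOn (fun k => e (g k)) (fun k _ => ?_) fun k _ l _ hkl => ?_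
  · have := hg k
    have := k.2
    simp only [coe_filter, mem_univ, true_and, Set.mem_ofPred_eq, hrank]
    exact ⟨by omega, hPg k⟩
  · have : g k = g l := e.injective hkl
    exact Fin.ext (by rw [← hg k, ← hg l, this])

/-- The element of `K` with coordinates `x` with respect to the conjugates of `α`. -/
def conjugateSum {F K : Type*} [Field F] [Fintype F] [Field K] [Algebra F K] {t : ℕ} (α : K)
    (x : Fin t → F) : K :=
  ∑ i : Fin t, x i • α ^ Fintype.card F ^ (i : ℕ)

section NormalBasis

variable {F K : Type*} [Field F] [Fintype F] [Field K] [Algebra F K] {t : ℕ} {α : K}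

lemma conjugateSum_injective
    (hα : LinearIndependent F fun i : Fin t => α ^ Fintype.card F ^ (i : ℕ)) :
    Function.Injective (conjugateSum α : (Fin t → F) → K) :=
  linearIndependent_iff_injective_fintypeLinearCombination.mp hα

lemma finrank_eq_of_card_eq_pow [Fintype K] (hK : Fintype.card K = Fintype.card F ^ t) :
    Module.finrank F K = t := by
  have := Module.card_eq_pow_finrank (K := F) (V := K)
  rw [hK] at this
  exact (Nat.pow_right_injective Fintype.one_lt_card this).symm

lemma frobeniusAlgHom_pow_apply (k : ℕ) (y : K) :
    (FiniteField.frobeniusAlgHom F K ^ k) y = y ^ Fintype.card F ^ k := by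
  rw [AlgHom.coe_pow, FiniteField.coe_frobeniusAlgHom, pow_iterate]

/-- Raising to the power `q ^ k` cyclically shifts coordinates. -/
lemma conjugateSum_pow [Fintype K] (hK : Fintype.card K = Fintype.card F ^ t) (x : Fin t → F)
    (k : Fin t) :
    conjugateSum α x ^ Fintype.card F ^ (k : ℕ) = conjugateSum α fun i => x (i - k) := by
  have : NeZero t := ⟨k.pos.ne'⟩
  have hmod : ∀ n, α ^ Fintype.card F ^ (n % t) = α ^ Fintype.card F ^ n := fun n => by
    conv_rhs => rw [← Nat.mod_add_div n t, pow_add, pow_mul, pow_mul, ← hK,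
      FiniteField.pow_card_pow]
  rw [← frobeniusAlgHom_pow_apply, conjugateSum, conjugateSum, map_sum]
  refine Fintype.sum_equiv (Equiv.addRight k) _ _ fun i => ?_
  rw [map_smul, frobeniusAlgHom_pow_apply]
  simp only [Equiv.coe_addRight, add_sub_cancel_right, Fin.val_add, hmod]
  rw [← pow_mul, pow_add]

/-- A vector of full period generates `K`. -/
lemma natDegree_minpoly_conjugateSum [Fintype K] (hK : Fintype.card K = Fintype.card F ^ t)
    (hα : LinearIndependent F fun i : Fin t => α ^ Fintype.card F ^ (i : ℕ))
    {x : Fin t → F} (hx : HasFullPeriod x) :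
    (minpoly F (conjugateSum α x)).natDegree = t := by
  classical
  have hint : IsIntegral F (conjugateSum α x) := .of_finite F _
  refine le_antisymm ((minpoly.natDegree_le _).trans_eq (finrank_eq_of_card_eq_pow hK)) ?_
  calc t = #(univ : Finset (Fin t)) := by simp
    _ ≤ #((minpoly F (conjugateSum α x)).aroots K).toFinset :=
      card_le_card_of_injOn (fun k => conjugateSum α x ^ Fintype.card F ^ (k : ℕ))
        (fun k _ => ?_) fun k _ l _ hkl => ?_
    _ ≤ Multiset.card ((minpoly F (conjugateSum α x)).aroots K) := Multiset.toFinset_card_le _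
    _ ≤ _ := (Polynomial.card_roots' _).trans Polynomial.natDegree_map_le
  · rw [mem_coe, Multiset.mem_toFinset, Polynomial.mem_aroots]
    refine ⟨minpoly.ne_zero hint, ?_⟩
    simp only [← frobeniusAlgHom_pow_apply, Polynomial.aeval_algHom_apply, minpoly.aeval, map_zero]
  · simp only [conjugateSum_pow hK] at hkl
    exact hx (conjugateSum_injective hα hkl)

/-- A polynomial arises as minimal polynomial from at most `t` vectors. -/
lemma card_filter_minpoly_conjugateSum_le [Fintype K] [DecidableEq (Polynomial F)]
    (hK : Fintype.card K = Fintype.card F ^ t)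
    (hα : LinearIndependent F fun i : Fin t => α ^ Fintype.card F ^ (i : ℕ))
    (s : Finset (Lex (Fin t → F))) (v : Lex (Fin t → F)) :
    #{w ∈ s | minpoly F (conjugateSum α (ofLex w)) = minpoly F (conjugateSum α (ofLex v))}
      ≤ t := by
  classical
  set p := minpoly F (conjugateSum α (ofLex v))
  calc _ ≤ #(p.aroots K).toFinset :=
      card_le_card_of_injOn (fun w => conjugateSum α (ofLex w)) (fun w hw => ?_)
        fun w _ w' _ h => ofLex.injective (conjugateSum_injective hα h)
    _ ≤ Multiset.card (p.aroots K) := Multiset.toFinset_card_le _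
    _ ≤ p.natDegree := (Polynomial.card_roots' _).trans Polynomial.natDegree_map_le
    _ ≤ t := (minpoly.natDegree_le _).trans_eq (finrank_eq_of_card_eq_pow hK)
  rw [mem_coe, mem_filter] at hw
  rw [mem_coe, Multiset.mem_toFinset, Polynomial.mem_aroots]
  refine ⟨minpoly.ne_zero (.of_finite F _), ?_⟩
  rw [← hw.2]
  exact minpoly.aeval _ _

end NormalBasis

open Classical in
/-- Every degree-`t` irreducible polynomial arises from exactly `t` period-`t` vectors
(its cyclic shifts), and at least one of every two consecutive vectors in the
lexicographic order on `F_q^t` has period `t`; hence the first `2tm` vectors of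
`F_q^t` in lexicographic order contain period-`t` vectors `λ` whose associated elements
`β_λ = Σᵢ λᵢ α^{qⁱ}` (via a normal basis `{α, α^q, …}`) generate at least `m` distinct
irreducible polynomials (their minimal polynomials) of degree `t` over `F_q`. -/
theorem first_vectors_generate_irreducibles {F K : Type*} [Field F] [Fintype F]
    [LinearOrder F] [Field K] [Fintype K] [Algebra F K]
    (t m : ℕ) (ht : 0 < t)
    (hK : Fintype.card K = Fintype.card F ^ t)
    (α : K)
    (hα : LinearIndependent F fun i : Fin t => α ^ Fintype.card F ^ (i : ℕ))
    (hm : 2 * t * m ≤ Fintype.card F ^ t) :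
    m ≤ (((Finset.univ.filter fun v : Lex (Fin t → F) =>
            (Finset.univ.filter fun w : Lex (Fin t → F) => w < v).card < 2 * t * m ∧
            HasFullPeriod (ofLex v))).image fun v =>
          minpoly F (∑ i : Fin t, (ofLex v : Fin t → F) i • α ^ Fintype.card F ^ (i : ℕ))).card ∧
    ∀ v : Lex (Fin t → F),
      (Finset.univ.filter fun w : Lex (Fin t → F) => w < v).card < 2 * t * m →
      HasFullPeriod (ofLex v) →
      Irreducible (minpoly F (∑ i : Fin t, (ofLex v : Fin t → F) i • α ^ Fintype.card F ^ (i : ℕ))) ∧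
      (minpoly F (∑ i : Fin t, (ofLex v : Fin t → F) i • α ^ Fintype.card F ^ (i : ℕ))).natDegree = t := by
  refine ⟨?_, fun v _ hv =>
    ⟨minpoly.irreducible (.of_finite F _), natDegree_minpoly_conjugateSum hK hα hv⟩⟩
  have hcount := le_card_filter_of_covBy (β := Lex (Fin t → F))
    (fun v => HasFullPeriod (ofLex v)) (fun _ _ => hasFullPeriod_or_of_covBy_lex) (n := t * m)
    (by
      rw [← mul_assoc]
      refine hm.trans_eq ?_
      exact (by simp : Fintype.card F ^ t = Fintype.card (Fin t → F)))
  rw [← mul_assoc] at hcount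
  refine Nat.le_of_mul_le_mul_left (hcount.trans ?_) ht
  refine (le_of_eq ?_).trans (card_le_mul_card_image _ t fun p hp => ?_)
  · congr!
  · obtain ⟨v, _, rfl⟩ := mem_image.mp hp
    exact card_filter_minpoly_conjugateSum_le hK hα _ v
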